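/- arXiv:0811.0580 — 3 statements merged into one kernel-verified Lean document; each statement's English description precedes it below -/
import Mathlib

section
/- Let 0 < δ ≤ T and c > 0. Let ζ be a finite signed Borel measure on O_{δ,T} := [δ,T]×[0,1] and let V : O_{δ,T} → ℝ be continuous. Suppose that (i) for every r ∈ [δ,T] and every continuous h : [0,1] → ℝ with ∫₀¹ h(θ)dθ = 0 one has ∫_{[r,T]×[0,1]} h(θ) dζ(t,θ) = 0, and (ii) for every r ∈ [δ,T], ∫₀¹ V(r,θ)dθ = c and ∫_{[r,T]×[0,1]} V(t,θ) dζ(t,θ) = 0. Then ζ is the null measure. -/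
open MeasureTheory Filter Set

/-- The integral of a function against a finite signed measure, defined via the
Jordan decomposition. -/
noncomputable def sintegral {X : Type*} [MeasurableSpace X]
    (ζ : MeasureTheory.SignedMeasure X) (f : X → ℝ) : ℝ :=
  (∫ x, f x ∂ζ.toJordanDecomposition.posPart) - ∫ x, f x ∂ζ.toJordanDecomposition.negPart

/-- The integral against a signed measure only depends on the difference of measures chosen to
represent it. -/
theorem sintegral_eq_of_eq_sub {X : Type*} [MeasurableSpace X] {ζ : SignedMeasure X}
    {μ ν : Measure X} [IsFiniteMeasure μ] [IsFiniteMeasure ν]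
    (hζ : ζ = μ.toSignedMeasure - ν.toSignedMeasure) {f : X → ℝ} (hf : StronglyMeasurable f)
    {C : ℝ} (hC : ∀ x, ‖f x‖ ≤ C) :
    sintegral ζ f = ∫ x, f x ∂μ - ∫ x, f x ∂ν := by
  have hInt (ρ : Measure X) [IsFiniteMeasure ρ] : Integrable f ρ :=
    Integrable.of_bound hf.aestronglyMeasurable C (ae_of_all _ hC)
  have hJ := ζ.toSignedMeasure_toJordanDecomposition
  rw [JordanDecomposition.toSignedMeasure, hζ, sub_eq_sub_iff_add_eq_add,
    ← Measure.toSignedMeasure_add, ← Measure.toSignedMeasure_add,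
    Measure.toSignedMeasure_eq_toSignedMeasure_iff, ← hζ] at hJ
  have h := congrArg (fun ρ => ∫ x, f x ∂ρ) hJ
  simp only [integral_add_measure (hInt _) (hInt _)] at h
  rw [sintegral]
  linarith

theorem sintegral_restrict {X : Type*} [MeasurableSpace X] (ζ : SignedMeasure X) {S : Set X}
    (hS : MeasurableSet S) {f : X → ℝ} (hf : StronglyMeasurable f)
    {C : ℝ} (hC : ∀ x, ‖f x‖ ≤ C) :
    sintegral (ζ.restrict S) f = ∫ x in S, f x ∂ζ.toJordanDecomposition.posPart
      - ∫ x in S, f x ∂ζ.toJordanDecomposition.negPart := by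
  refine sintegral_eq_of_eq_sub ?_ hf hC
  conv_lhs => rw [← ζ.toSignedMeasure_toJordanDecomposition, JordanDecomposition.toSignedMeasure]
  rw [VectorMeasure.restrict_sub, VectorMeasure.restrict_toSignedMeasure hS,
    VectorMeasure.restrict_toSignedMeasure hS]

/-- Finite measures on a product are equal if they integrate every bounded continuous function of
the second variable to the same value over each strip over `Ici a`. -/
theorem ext_of_forall_setIntegral_Ici_prod_univ {α β : Type*}
    [TopologicalSpace α] [MeasurableSpace α] [SecondCountableTopology α] [LinearOrder α]
    [OrderTopology α] [BorelSpace α]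
    [TopologicalSpace β] [MeasurableSpace β] [HasOuterApproxClosed β] [BorelSpace β]
    {μ ν : Measure (α × β)} [IsFiniteMeasure μ] [IsFiniteMeasure ν]
    (h : ∀ (a : α) (f : BoundedContinuousFunction β ℝ),
      ∫ x in Ici a ×ˢ univ, f x.2 ∂μ = ∫ x in Ici a ×ˢ univ, f x.2 ∂ν) :
    μ = ν := by
  have hsnd (a : α) : (μ.restrict (Ici a ×ˢ univ)).map Prod.snd =
      (ν.restrict (Ici a ×ˢ univ)).map Prod.snd := by
    refine ext_of_forall_integral_eq_of_IsFiniteMeasure fun f => ?_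
    rw [integral_map measurable_snd.aemeasurable
        f.continuous.measurable.aestronglyMeasurable,
      integral_map measurable_snd.aemeasurable f.continuous.measurable.aestronglyMeasurable]
    exact h a f
  refine Measure.ext_prod fun {s t} hs ht => ?_
  have hfst : (μ.restrict (univ ×ˢ t)).map Prod.fst = (ν.restrict (univ ×ˢ t)).map Prod.fst := by
    refine Measure.ext_of_Ici _ _ fun a => ?_
    have := congrArg (fun ρ => ρ t) (hsnd a)
    simp only [Measure.map_apply measurable_snd ht,
      Measure.restrict_apply (measurable_snd ht)] at this
    rw [Measure.map_apply measurable_fst measurableSet_Ici,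
      Measure.map_apply measurable_fst measurableSet_Ici,
      Measure.restrict_apply (measurable_fst measurableSet_Ici),
      Measure.restrict_apply (measurable_fst measurableSet_Ici)]
    convert! this using 2 <;> ext <;> simp [and_comm]
  have := congrArg (fun ρ => ρ s) hfst
  simp only [Measure.map_apply measurable_fst hs,
    Measure.restrict_apply (measurable_fst hs)] at this
  convert! this using 2 <;> ext <;> simp

theorem setIntegral_Ici_prod_univ_prod {α β : Type*} [MeasurableSpace α] [Preorder α]
    [MeasurableSpace β] (μ : Measure α) [IsFiniteMeasure μ] (ν : Measure β) [IsProbabilityMeasure ν]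
    {f : α × β → ℝ} (hf : Integrable f (μ.prod ν)) (a : α) {m : ℝ}
    (hm : ∀ x, ∫ y, f (x, y) ∂ν = m) :
    ∫ x in Ici a ×ˢ univ, f x ∂(μ.prod ν) = μ.real (Ici a) * m := by
  rw [setIntegral_prod _ hf.integrableOn]
  simp [hm]

theorem stmt0 (δ T c : ℝ) (hδ : 0 < δ) (hδT : δ ≤ T) (hc : 0 < c)
    (ζ : MeasureTheory.SignedMeasure (Icc δ T × Icc (0:ℝ) 1))
    (V : Icc δ T × Icc (0:ℝ) 1 → ℝ) (hV : Continuous V)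
    (h1 : ∀ r ∈ Icc δ T, ∀ h : Icc (0:ℝ) 1 → ℝ, Continuous h →
      (∫ θ : Icc (0:ℝ) 1, h θ) = 0 →
      sintegral (ζ.restrict {p : Icc δ T × Icc (0:ℝ) 1 | r ≤ (p.1 : ℝ)})
        (fun p => h p.2) = 0)
    (h2 : ∀ (r : ℝ) (hr : r ∈ Icc δ T),
      (∫ θ : Icc (0:ℝ) 1, V (⟨r, hr⟩, θ)) = c ∧
      sintegral (ζ.restrict {p : Icc δ T × Icc (0:ℝ) 1 | r ≤ (p.1 : ℝ)}) V = 0) :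
    ζ = 0 := by
  set P := ζ.toJordanDecomposition.posPart
  set N := ζ.toJordanDecomposition.negPart
  have hS (a : Icc δ T) : {p : Icc δ T × Icc (0:ℝ) 1 | (a : ℝ) ≤ (p.1 : ℝ)} = Ici a ×ˢ univ := by
    ext p
    simp
  have hSm (a : Icc δ T) : MeasurableSet (Ici a ×ˢ (univ : Set (Icc (0:ℝ) 1))) :=
    measurableSet_Ici.prod .univ
  have hbdd {f : Icc δ T × Icc (0:ℝ) 1 → ℝ} (hf : Continuous f) : ∃ C, ∀ x, ‖f x‖ ≤ C := by
    obtain ⟨C, hC⟩ := isCompact_univ.exists_bound_of_continuousOn hf.continuousOn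
    exact ⟨C, fun x => hC x (mem_univ x)⟩
  have hInt {f : Icc δ T × Icc (0:ℝ) 1 → ℝ} (hf : Continuous f)
      (ρ : Measure (Icc δ T × Icc (0:ℝ) 1)) [IsFiniteMeasure ρ] : Integrable f ρ := by
    obtain ⟨C, hC⟩ := hbdd hf
    exact Integrable.of_bound hf.stronglyMeasurable.aestronglyMeasurable C (ae_of_all _ hC)
  have hsint {f : Icc δ T × Icc (0:ℝ) 1 → ℝ} (hf : Continuous f) (a : Icc δ T)
      (h0 : sintegral (ζ.restrict {p : Icc δ T × Icc (0:ℝ) 1 | (a : ℝ) ≤ (p.1 : ℝ)}) f = 0) :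
      ∫ x in Ici a ×ˢ univ, f x ∂P = ∫ x in Ici a ×ˢ univ, f x ∂N := by
    obtain ⟨C, hC⟩ := hbdd hf
    rw [hS, sintegral_restrict ζ (hSm a) hf.stronglyMeasurable hC] at h0
    exact sub_eq_zero.mp h0
  have hfst (ρ : Measure (Icc δ T × Icc (0:ℝ) 1)) (a : Icc δ T) :
      ρ.fst.real (Ici a) = ρ.real (Ici a ×ˢ univ) := by
    rw [measureReal_def, Measure.fst_apply measurableSet_Ici, measureReal_def, prod_univ]
  have hsum : P + N.fst.prod volume = N + P.fst.prod volume := by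
    refine ext_of_forall_setIntegral_Ici_prod_univ fun a f => ?_
    have hf : Continuous fun p : Icc δ T × Icc (0:ℝ) 1 => f p.2 := f.continuous.comp continuous_snd
    set m := ∫ θ, f θ with hm
    have hmean : ∫ θ, (f θ - m) = 0 := by
      rw [integral_sub (f.integrable _) (integrable_const _)]
      simp [hm]
    have key := hsint (hf.sub continuous_const) a
      (h1 a a.2 (fun θ => f θ - m) (f.continuous.sub continuous_const) hmean)
    rw [integral_sub' (hInt hf _) (integrable_const _),
      integral_sub' (hInt hf _) (integrable_const _)] at key
    simp only [integral_const, measureReal_restrict_apply_univ, smul_eq_mul] at key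
    rw [Measure.restrict_add, Measure.restrict_add,
      integral_add_measure (hInt hf _) (hInt hf _), integral_add_measure (hInt hf _) (hInt hf _),
      setIntegral_Ici_prod_univ_prod _ _ (hInt hf _) a (fun _ => hm.symm),
      setIntegral_Ici_prod_univ_prod _ _ (hInt hf _) a (fun _ => hm.symm), hfst, hfst]
    linarith
  have hmarg : P.fst = N.fst := by
    refine Measure.ext_of_Ici _ _ fun a => ?_
    have hI := congrArg (fun ρ => ∫ x in Ici a ×ˢ univ, V x ∂ρ) hsum
    simp only [Measure.restrict_add] at hI
    rw [integral_add_measure (hInt hV _) (hInt hV _), integral_add_measure (hInt hV _) (hInt hV _),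
      setIntegral_Ici_prod_univ_prod _ _ (hInt hV _) a (fun x => (h2 x x.2).1),
      setIntegral_Ici_prod_univ_prod _ _ (hInt hV _) a (fun x => (h2 x x.2).1),
      hsint hV a (h2 a a.2).2] at hI
    rw [← measureReal_eq_measureReal_iff]
    exact (mul_right_cancel₀ hc.ne' (add_left_cancel hI)).symm
  have hPN : P = N := by
    rw [hmarg] at hsum
    ext s hs
    have := congrArg (fun ρ => ρ s) hsum
    simp only [Measure.add_apply] at this
    exact (ENNReal.add_left_inj (measure_ne_top _ _)).mp this
  rw [← ζ.toSignedMeasure_toJordanDecomposition, JordanDecomposition.toSignedMeasure, sub_eq_zero]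
  exact Measure.toSignedMeasure_congr hPN
end

section
/- Let E be a Polish space equipped with its Borel σ-algebra and let (Z_n)_{n≥1} be a sequence of E-valued random variables on a probability space (Ω, F, P). Then (Z_n) converges in probability to some E-valued random variable if and only if from every pair of subsequences (Z_{n¹_k})_{k≥1} and (Z_{n²_k})_{k≥1} one can extract a further subsequence along which the joint laws of the pairs (Z_{n¹_k}, Z_{n²_k}) converge weakly to a probability measure on E×E concentrated on the diagonal {(x,y) ∈ E×E : x = y}. -/
open MeasureTheory Filter

open Topology BoundedContinuousFunction

/-- A sequence that is Cauchy in probability has an almost surely convergent subsequence. -/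
theorem exists_subseq_tendsto_ae_of_cauchyInMeasure {Ω E : Type*} [MeasurableSpace Ω]
    [MetricSpace E] [CompleteSpace E] (P : Measure Ω) [IsProbabilityMeasure P] (Z : ℕ → Ω → E)
    (hC : ∀ ε > 0, ∃ N, ∀ m ≥ N, ∀ n ≥ N, P.real {ω | ε ≤ dist (Z m ω) (Z n ω)} ≤ ε) :
    ∃ (ns : ℕ → ℕ) (Zlim : Ω → E), StrictMono ns ∧
      ∀ᵐ ω ∂P, Tendsto (fun k => Z (ns k) ω) atTop (𝓝 (Zlim ω)) := by
  obtain ⟨ω₀⟩ : Nonempty Ω := nonempty_of_isProbabilityMeasure P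
  have : Nonempty E := ⟨Z 0 ω₀⟩
  obtain ⟨ns, hns, hsmall⟩ := extraction_forall_of_eventually' (P := fun k N =>
      ∀ m ≥ N, ∀ n ≥ N, P.real {ω | (1 / 2 : ℝ) ^ k ≤ dist (Z m ω) (Z n ω)} ≤ (1 / 2) ^ k)
    fun k => (hC _ (by positivity)).imp fun N hN l hl m hm n hn =>
      hN m (hl.trans hm) n (hl.trans hn)
  have hsum : ∑' k, P {ω | (1 / 2 : ℝ) ^ k ≤ dist (Z (ns k) ω) (Z (ns (k + 1)) ω)} ≠ ⊤ := by
    refine ne_top_of_le_ne_top summable_geometric_two.tsum_ofReal_ne_top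
      (ENNReal.tsum_le_tsum fun k => ?_)
    rw [← ofReal_measureReal]
    exact ENNReal.ofReal_le_ofReal
      (hsmall k _ le_rfl _ (hns.monotone k.le_succ))
  have hlim : ∀ᵐ ω ∂P, ∃ z, Tendsto (fun k => Z (ns k) ω) atTop (𝓝 z) := by
    filter_upwards [ae_eventually_notMem hsum] with ω hω
    refine cauchySeq_tendsto_of_complete (cauchySeq_of_summable_dist ?_)
    refine Summable.of_norm_bounded_eventually_nat summable_geometric_two ?_
    filter_upwards [hω] with k hk
    rw [Real.norm_of_nonneg dist_nonneg]
    exact (not_le.1 hk).le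
  refine ⟨ns, fun ω => Classical.epsilon fun z => Tendsto (fun k => Z (ns k) ω) atTop (𝓝 z),
    hns, ?_⟩
  filter_upwards [hlim] with ω hω using Classical.epsilon_spec hω

/-- In a complete space, a sequence that is Cauchy in probability converges in probability. -/
theorem exists_tendstoInMeasure_of_cauchyInMeasure {Ω E : Type*} [MeasurableSpace Ω]
    [MetricSpace E] [CompleteSpace E] (P : Measure Ω) [IsProbabilityMeasure P] (Z : ℕ → Ω → E)
    (hZ : ∀ n, AEStronglyMeasurable (Z n) P)
    (hC : ∀ ε > 0, ∃ N, ∀ m ≥ N, ∀ n ≥ N, P.real {ω | ε ≤ dist (Z m ω) (Z n ω)} ≤ ε) :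
    ∃ Zlim : Ω → E, TendstoInMeasure P Z atTop Zlim := by
  obtain ⟨ns, Zlim, hns, hlim⟩ := exists_subseq_tendsto_ae_of_cauchyInMeasure P Z hC
  have hsub := tendstoInMeasure_iff_measureReal_dist.1
    (tendstoInMeasure_of_tendsto_ae (fun k => hZ (ns k)) hlim)
  refine ⟨Zlim, tendstoInMeasure_iff_measureReal_dist.2 fun ε hε => ?_⟩
  rw [Metric.tendsto_atTop]
  intro δ hδ
  obtain ⟨N, hN⟩ := hC (min (ε / 2) (δ / 2)) (by positivity)
  obtain ⟨k, hk, hkN⟩ := (((hsub (ε / 2) (by positivity)).eventually_lt_const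
    (half_pos hδ)).and (eventually_ge_atTop N)).exists
  refine ⟨N, fun n hn => ?_⟩
  rw [Real.dist_0_eq_abs, abs_of_nonneg measureReal_nonneg]
  have hcover : {ω | ε ≤ dist (Z n ω) (Zlim ω)} ⊆
      {ω | min (ε / 2) (δ / 2) ≤ dist (Z n ω) (Z (ns k) ω)} ∪
        {ω | ε / 2 ≤ dist (Z (ns k) ω) (Zlim ω)} := by
    intro ω hω
    simp only [Set.mem_union, Set.mem_ofPred_eq] at hω ⊢
    by_contra! h
    linarith [dist_triangle (Z n ω) (Z (ns k) ω) (Zlim ω), min_le_left (ε / 2) (δ / 2)]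
  have hNn := hN n hn (ns k) (hkN.trans (hns.id_le k))
  linarith [measureReal_mono (μ := P) hcover, measureReal_union_le (μ := P)
    {ω | min (ε / 2) (δ / 2) ≤ dist (Z n ω) (Z (ns k) ω)}
    {ω | ε / 2 ≤ dist (Z (ns k) ω) (Zlim ω)}, min_le_right (ε / 2) (δ / 2)]

/-- The truncated distance `min (dist x y) 1` as a bounded continuous function of `(x, y)`. -/
noncomputable def truncatedDist (E : Type*) [MetricSpace E] : E × E →ᵇ ℝ :=
  BoundedContinuousFunction.ofNormedAddCommGroup (fun p => min (dist p.1 p.2) 1)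
    (by fun_prop) 1 fun p => by
      rw [Real.norm_of_nonneg (by positivity)]
      exact min_le_right _ _

theorem truncatedDist_apply {E : Type*} [MetricSpace E] (p : E × E) :
    truncatedDist E p = min (dist p.1 p.2) 1 := rfl

/-- If the joint laws of `(X k, Y k)` converge weakly to a law concentrated on the diagonal, then
the distance between `X k` and `Y k` tends to zero in probability. -/
theorem tendsto_measureReal_dist_of_tendsto_diagonal {Ω E : Type*} [MeasurableSpace Ω]
    [MetricSpace E] [SecondCountableTopology E] [MeasurableSpace E] [BorelSpace E]
    (P : Measure Ω) [IsProbabilityMeasure P] (X Y : ℕ → Ω → E)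
    (hX : ∀ k, Measurable (X k)) (hY : ∀ k, Measurable (Y k))
    (μ : Measure (E × E)) (hdiag : μ {p : E × E | p.1 = p.2}ᶜ = 0)
    (hlim : ∀ f : E × E →ᵇ ℝ,
      Tendsto (fun k => ∫ p, f p ∂(P.map fun ω => (X k ω, Y k ω))) atTop (𝓝 (∫ p, f p ∂μ)))
    {ε : ℝ} (hε : 0 < ε) :
    Tendsto (fun k => P.real {ω | ε ≤ dist (X k ω) (Y k ω)}) atTop (𝓝 0) := by
  have hzero : ∫ p, truncatedDist E p ∂μ = 0 := by
    refine integral_eq_zero_of_ae ?_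
    have hdiag' : ∀ᵐ p ∂μ, p.1 = p.2 := hdiag
    filter_upwards [hdiag'] with p hp
    simp [truncatedDist_apply, hp]
  have hlim' := hlim (truncatedDist E)
  rw [hzero] at hlim'
  have hc : 0 < min ε 1 := by positivity
  have hdiv := hlim'.const_mul (min ε 1)⁻¹
  rw [mul_zero] at hdiv
  refine squeeze_zero (fun k => measureReal_nonneg) (fun k => ?_) hdiv
  have hXY : Measurable fun ω => (X k ω, Y k ω) := (hX k).prodMk (hY k)
  have := Measure.isProbabilityMeasure_map (μ := P) hXY.aemeasurable
  have hmap := integral_map (μ := P) hXY.aemeasurable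
    (truncatedDist E).continuous.aestronglyMeasurable
  have hint : Integrable (fun ω => truncatedDist E (X k ω, Y k ω)) P :=
    ((truncatedDist E).integrable _).comp_measurable hXY
  rw [hmap, inv_mul_eq_div, le_div_iff₀' hc]
  refine le_trans ?_ (mul_meas_ge_le_integral_of_nonneg
    (ae_of_all _ fun ω => by simp [truncatedDist_apply]) hint (min ε 1))
  refine mul_le_mul_of_nonneg_left (measureReal_mono fun ω hω => ?_) hc.le
  exact min_le_min_right 1 (show ε ≤ dist (X k ω) (Y k ω) from hω)

/-- Two subsequences of a sequence converging in probability have a common further subsequence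
along which the pairs converge weakly to a law concentrated on the diagonal. -/
theorem exists_subseq_tendsto_diagonal_of_tendstoInMeasure {Ω E : Type*} [MeasurableSpace Ω]
    [MetricSpace E] [SecondCountableTopology E] [MeasurableSpace E] [BorelSpace E]
    (P : Measure Ω) [IsProbabilityMeasure P] (X Y : ℕ → Ω → E) (W : Ω → E)
    (hX : ∀ k, Measurable (X k)) (hY : ∀ k, Measurable (Y k))
    (hXW : TendstoInMeasure P X atTop W) (hYW : TendstoInMeasure P Y atTop W) :
    ∃ φ : ℕ → ℕ, StrictMono φ ∧ ∃ μ : Measure (E × E), IsProbabilityMeasure μ ∧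
      μ {p : E × E | p.1 = p.2}ᶜ = 0 ∧ ∀ f : E × E →ᵇ ℝ,
        Tendsto (fun k => ∫ p, f p ∂(P.map fun ω => (X (φ k) ω, Y (φ k) ω))) atTop
          (𝓝 (∫ p, f p ∂μ)) := by
  have hW : AEMeasurable W P := hXW.aemeasurable fun k => (hX k).aemeasurable
  obtain ⟨φ, hφ, hφX⟩ := hXW.exists_seq_tendsto_ae
  obtain ⟨ψ, hψ, hψY⟩ := (hYW.comp hφ.tendsto_atTop).exists_seq_tendsto_ae
  have hWW : AEMeasurable (fun ω => (W ω, W ω)) P := hW.prodMk hW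
  refine ⟨φ ∘ ψ, hφ.comp hψ, P.map fun ω => (W ω, W ω),
    Measure.isProbabilityMeasure_map hWW, ?_, fun f => ?_⟩
  · rw [show {p : E × E | p.1 = p.2} = Set.diagonal E from rfl,
      Measure.map_apply_of_aemeasurable hWW measurableSet_diagonal.compl,
      Set.preimage_compl, Set.preimage_eq_univ_iff.2 (by rintro _ ⟨ω, rfl⟩; rfl),
      Set.compl_univ, measure_empty]
  · have hXY (k : ℕ) : Measurable fun ω => (X ((φ ∘ ψ) k) ω, Y ((φ ∘ ψ) k) ω) :=
      (hX _).prodMk (hY _)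
    simp_rw [integral_map (hXY _).aemeasurable f.continuous.aestronglyMeasurable,
      integral_map hWW f.continuous.aestronglyMeasurable]
    refine tendsto_integral_of_dominated_convergence (fun _ => ‖f‖)
      (fun k => f.continuous.comp_aestronglyMeasurable (hXY k).aestronglyMeasurable)
      (integrable_const _) (fun k => ae_of_all _ fun ω => f.norm_coe_le_norm _) ?_
    filter_upwards [hφX, hψY] with ω hω₁ hω₂
    exact (f.continuous.tendsto _).comp
      ((hω₁.comp hψ.tendsto_atTop).prodMk_nhds hω₂)

theorem stmt2 {Ω E : Type*} [MeasurableSpace Ω]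
    [MetricSpace E] [CompleteSpace E] [TopologicalSpace.SeparableSpace E]
    [MeasurableSpace E] [BorelSpace E]
    (P : Measure Ω) [IsProbabilityMeasure P]
    (Z : ℕ → Ω → E) (hZ : ∀ n, Measurable (Z n)) :
    (∃ Zlim : Ω → E, TendstoInMeasure P Z atTop Zlim) ↔
      ∀ n₁ n₂ : ℕ → ℕ, StrictMono n₁ → StrictMono n₂ →
        ∃ φ : ℕ → ℕ, StrictMono φ ∧
          ∃ μ : Measure (E × E), IsProbabilityMeasure μ ∧
            μ {p : E × E | p.1 = p.2}ᶜ = 0 ∧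
            ∀ f : BoundedContinuousFunction (E × E) ℝ,
              Tendsto
                (fun k => ∫ p, f p ∂(P.map (fun ω => (Z (n₁ (φ k)) ω, Z (n₂ (φ k)) ω))))
                atTop (nhds (∫ p, f p ∂μ)) := by
  have : SecondCountableTopology E := UniformSpace.secondCountable_of_separable E
  constructor
  · rintro ⟨Zlim, hlim⟩ n₁ n₂ h₁ h₂
    exact exists_subseq_tendsto_diagonal_of_tendstoInMeasure P (fun k => Z (n₁ k))
      (fun k => Z (n₂ k)) Zlim (fun k => hZ _) (fun k => hZ _)
      (hlim.comp h₁.tendsto_atTop) (hlim.comp h₂.tendsto_atTop)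
  · intro h
    refine exists_tendstoInMeasure_of_cauchyInMeasure P Z
      (fun n => (hZ n).aestronglyMeasurable) fun ε hε => ?_
    by_contra! hbad
    choose m hm n hn hmn using hbad
    obtain ⟨φ, hφ, hmφ⟩ := strictMono_subseq_of_tendsto_atTop
      (tendsto_atTop_mono hm tendsto_id)
    obtain ⟨ψ, hψ, hnψ⟩ := strictMono_subseq_of_tendsto_atTop
      ((tendsto_atTop_mono hn tendsto_id).comp hφ.tendsto_atTop)
    obtain ⟨θ, -, μ, -, hdiag, hlim⟩ := h _ _ (hmφ.comp hψ) hnψ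
    have hdist := tendsto_measureReal_dist_of_tendsto_diagonal P _ _ (fun k => hZ _)
      (fun k => hZ _) μ hdiag hlim hε
    obtain ⟨k, hk⟩ := (hdist.eventually_lt_const hε).exists
    exact (hmn (φ (ψ (θ k)))).not_gt hk
end

section
/- Let μ be a finite Borel measure on L²(0,1) and let ψ : L²(0,1) → ℝ be bounded and continuous. Then ∫ ψ(x)·exp(−∫₀¹ F^n_ln(x(θ))dθ) μ(dx) converges, as n → ∞, to ∫ ψ(x)·exp(−∫₀¹ (x(θ)·log x(θ) − x(θ) + 1) dθ)·1_{x ∈ K} μ(dx). -/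
open MeasureTheory Filter Set

/-- Lebesgue measure on `(0,1)`. -/
noncomputable def leb01 : MeasureTheory.Measure ℝ := volume.restrict (Set.Ioo (0:ℝ) 1)

/-- The space `L²(0,1)`. -/
noncomputable abbrev L2 := MeasureTheory.Lp ℝ 2 leb01

/-- The regularized logarithmic potential `F^n_ln`. -/
noncomputable def Fln (n : ℕ) (x : ℝ) : ℝ :=
  (x + 1 / n) * Real.log (max x 0 + 1 / n) - max x 0 + 1 - 1 / n

/-- The cone of nonnegative elements of `L²(0,1)`. -/
def Kcone : Set L2 := {g : L2 | ∀ᵐ θ ∂leb01, 0 ≤ g θ}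

instance : IsFiniteMeasure leb01 := by
  unfold leb01
  infer_instance

/-- `Fln n` is Lipschitz with a constant growing linearly in its arguments. -/
theorem exists_abs_Fln_sub_le {n : ℕ} (hn : 1 ≤ n) :
    ∃ C : ℝ, 0 ≤ C ∧ ∀ x y : ℝ, |Fln n x - Fln n y| ≤ C * ((1 + |x| + |y|) * |x - y|) := by
  obtain ⟨e, he⟩ : ∃ e : ℝ, e = 1 / n := ⟨_, rfl⟩
  have hn' : (0 : ℝ) < n := by exact_mod_cast hn
  have e0 : 0 < e := by rw [he]; positivity
  have log_sub_le : ∀ a b : ℝ, e ≤ a → e ≤ b → Real.log a - Real.log b ≤ e⁻¹ * |a - b| := by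
    intro a b ha hb
    have ha0 := e0.trans_le ha
    have hb0 := e0.trans_le hb
    rw [← Real.log_div ha0.ne' hb0.ne']
    have h1 := Real.log_le_sub_one_of_pos (div_pos ha0 hb0)
    have h2 : a / b - 1 = b⁻¹ * (a - b) := by field_simp
    have h3 : b⁻¹ ≤ e⁻¹ := inv_anti₀ e0 hb
    calc _ ≤ b⁻¹ * (a - b) := by linarith
      _ ≤ b⁻¹ * |a - b| := by gcongr; exact le_abs_self _
      _ ≤ _ := by gcongr
  refine ⟨e + 2 * e⁻¹ + 3, by positivity, fun x y => ?_⟩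
  have hmax : ∀ z : ℝ, max z 0 ≤ |z| := fun z => max_le (le_abs_self z) (abs_nonneg z)
  have ha : e ≤ max x 0 + e := by linarith [le_max_right x 0]
  have hb : e ≤ max y 0 + e := by linarith [le_max_right y 0]
  have hm : |max x 0 - max y 0| ≤ |x - y| := abs_max_sub_max_le_abs x y 0
  have hlog : |Real.log (max x 0 + e)| ≤ |x| + e + e⁻¹ := by
    have h1 := Real.log_le_sub_one_of_pos (e0.trans_le ha)
    have h2 := Real.one_sub_inv_le_log_of_pos (e0.trans_le ha)
    have h3 : (max x 0 + e)⁻¹ ≤ e⁻¹ := inv_anti₀ e0 ha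
    have := hmax x
    have : 0 < e⁻¹ := by positivity
    have := abs_nonneg x
    rw [abs_le]
    constructor <;> linarith
  have hdiff : |Real.log (max x 0 + e) - Real.log (max y 0 + e)| ≤ e⁻¹ * |x - y| := by
    have key : e⁻¹ * |(max x 0 + e) - (max y 0 + e)| ≤ e⁻¹ * |x - y| := by
      rw [add_sub_add_right_eq_sub]
      gcongr
    rw [abs_le]
    have h1 := log_sub_le _ _ ha hb
    have h2 := log_sub_le _ _ hb ha
    rw [abs_sub_comm] at h2
    constructor <;> linarith
  have hy : |y + e| ≤ |y| + e := (abs_add_le y e).trans_eq (by rw [abs_of_pos e0])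
  have hF : Fln n x - Fln n y = (x - y) * Real.log (max x 0 + e)
      + (y + e) * (Real.log (max x 0 + e) - Real.log (max y 0 + e))
      - (max x 0 - max y 0) := by
    simp only [Fln, ← he]
    ring
  rw [hF]
  calc _ ≤ |x - y| * |Real.log (max x 0 + e)|
      + |y + e| * |Real.log (max x 0 + e) - Real.log (max y 0 + e)|
      + |max x 0 - max y 0| := by
        refine (abs_sub _ _).trans ?_
        rw [← abs_mul, ← abs_mul]
        gcongr
        exact abs_add_le _ _
    _ ≤ |x - y| * (|x| + e + e⁻¹) + (|y| + e) * (e⁻¹ * |x - y|) + |x - y| := by gcongr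
    _ = (|x| + e + e⁻¹ + |y| * e⁻¹ + 1 + 1) * |x - y| := by field_simp; ring
    _ ≤ ((e + 2 * e⁻¹ + 3) * (1 + |x| + |y|)) * |x - y| := by
        gcongr
        have := abs_nonneg x
        have := abs_nonneg y
        have : 0 < e⁻¹ := by positivity
        have : 0 ≤ e * |x| := by positivity
        have : 0 ≤ e * |y| := by positivity
        have : 0 ≤ e⁻¹ * |x| := by positivity
        have : 0 ≤ e⁻¹ * |y| := by positivity
        nlinarith
    _ = _ := by ring

theorem negPart_mul_log_le_Fln {n : ℕ} (hn : 1 ≤ n) (x : ℝ) :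
    max (-x) 0 * Real.log n ≤ Fln n x := by
  have hn' : (0 : ℝ) < n := by exact_mod_cast hn
  have aux : ∀ y : ℝ, 0 < y → 0 ≤ y * Real.log y - y + 1 := by
    intro y hy
    have := mul_le_mul_of_nonneg_left (Real.one_sub_inv_le_log_of_pos hy) hy.le
    rw [mul_sub, mul_inv_cancel₀ hy.ne'] at this
    linarith
  rcases le_total 0 x with hx | hx
  · have := aux (x + 1 / n) (by positivity)
    rw [max_eq_right (by linarith), Fln, max_eq_left hx]
    linarith
  · have := aux (1 / n) (by positivity)
    rw [max_eq_left (by linarith), Fln, max_eq_right hx, zero_add, one_div, Real.log_inv]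
    rw [one_div, Real.log_inv] at this
    linarith

theorem Fln_nonneg {n : ℕ} (hn : 1 ≤ n) (x : ℝ) : 0 ≤ Fln n x :=
  (mul_nonneg (le_max_right _ _) (Real.log_natCast_nonneg n)).trans (negPart_mul_log_le_Fln hn x)

theorem Fln_le_sq {n : ℕ} (hn : 1 ≤ n) {x : ℝ} (hx : 0 ≤ x) : Fln n x ≤ (1 + x) ^ 2 := by
  have hn' : (1 : ℝ) ≤ n := by exact_mod_cast hn
  have h1 : 1 / (n : ℝ) ≤ 1 := by rw [div_le_one (by linarith)]; exact hn'
  have h0 : 0 < 1 / (n : ℝ) := by positivity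
  rw [Fln, max_eq_left hx]
  have hy : 0 < x + 1 / (n : ℝ) := by linarith
  have := mul_le_mul_of_nonneg_left (Real.log_le_sub_one_of_pos hy) hy.le
  nlinarith

theorem measurable_Fln (n : ℕ) : Measurable (Fln n) := by
  unfold Fln
  fun_prop

theorem tendsto_Fln {x : ℝ} (hx : 0 ≤ x) :
    Tendsto (fun n : ℕ => Fln n x) atTop (nhds (x * Real.log x - x + 1)) := by
  have h1 : Tendsto (fun n : ℕ => 1 / (n : ℝ)) atTop (nhds 0) := tendsto_one_div_atTop_nhds_zero_nat
  have h2 : Tendsto (fun n : ℕ => x + 1 / (n : ℝ)) atTop (nhds x) := by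
    simpa using h1.const_add x
  have h3 := (Real.continuous_mul_log.tendsto x).comp h2
  simpa [Fln, max_eq_left hx, Function.comp_def] using ((h3.sub_const x).add_const 1).sub h1

theorem integrable_Fln {n : ℕ} (hn : 1 ≤ n) (f : L2) :
    Integrable (fun θ => Fln n (f θ)) leb01 := by
  obtain ⟨C, hC, h⟩ := exists_abs_Fln_sub_le hn
  have hf := Lp.memLp f
  have hI : Integrable (fun θ => |Fln n 0| + C * (|f θ| + f θ ^ 2)) leb01 :=
    (integrable_const _).add
      (((hf.integrable one_le_two).abs.add hf.integrable_sq).const_mul C)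
  refine hI.mono'
    ((measurable_Fln n).comp_aemeasurable hf.aestronglyMeasurable.aemeasurable).aestronglyMeasurable
    (ae_of_all _ fun θ => ?_)
  have h1 := h (f θ) 0
  have h2 : |Fln n (f θ)| ≤ |Fln n 0| + |Fln n (f θ) - Fln n 0| := by
    simpa using abs_add_le (Fln n 0) (Fln n (f θ) - Fln n 0)
  simp only [abs_zero, add_zero, sub_zero] at h1
  have h3 : (1 + |f θ|) * |f θ| = |f θ| + f θ ^ 2 := by rw [← sq_abs]; ring
  rw [h3] at h1
  simpa using h2.trans (by linarith)

theorem continuous_integral_Fln {n : ℕ} (hn : 1 ≤ n) :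
    Continuous (fun f : L2 => ∫ θ, Fln n (f θ) ∂leb01) := by
  obtain ⟨C, hC, h⟩ := exists_abs_Fln_sub_le hn
  rw [continuous_iff_continuousAt]
  intro f
  let one : L2 := Lp.const 2 leb01 (1 : ℝ)
  have bound : ∀ g : L2, ‖(∫ θ, Fln n (g θ) ∂leb01) - ∫ θ, Fln n (f θ) ∂leb01‖ ≤
      C * ((‖one‖ + ‖g‖ + ‖f‖) * ‖g - f‖) := by
    intro g
    have hinner : (fun θ => (1 + |g θ| + |f θ|) * |g θ - f θ|) =ᵐ[leb01]
        fun θ => inner ℝ ((one + |g| + |f| : L2) θ) ((|g - f| : L2) θ) := by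
      filter_upwards [Lp.coeFn_add (one + |g|) |f|, Lp.coeFn_add one |g|, Lp.coeFn_abs g,
        Lp.coeFn_abs f, Lp.coeFn_abs (g - f), Lp.coeFn_sub g f,
        Lp.coeFn_const (p := 2) (μ := leb01) (1 : ℝ)] with θ h1 h2 h3 h4 h5 h6 h7
      rw [h1, Pi.add_apply, h2, Pi.add_apply, h3, h4, h5, h6, Pi.sub_apply, h7,
        Function.const_apply, RCLike.inner_apply, conj_trivial, mul_comm]
    have hint : Integrable (fun θ => (1 + |g θ| + |f θ|) * |g θ - f θ|) leb01 :=
      (L2.integrable_inner (𝕜 := ℝ) _ _).congr hinner.symm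
    rw [← integral_sub (integrable_Fln hn g) (integrable_Fln hn f)]
    refine (norm_integral_le_of_norm_le (hint.const_mul C) (ae_of_all _ fun θ => h _ _)).trans ?_
    rw [integral_const_mul, integral_congr_ae hinner, ← L2.inner_def]
    gcongr
    refine (real_inner_le_norm _ _).trans ?_
    rw [norm_abs_eq_norm]
    gcongr
    refine (norm_add₃_le).trans_eq ?_
    rw [norm_abs_eq_norm, norm_abs_eq_norm]
  rw [ContinuousAt, tendsto_iff_norm_sub_tendsto_zero]
  refine squeeze_zero (fun _ => norm_nonneg _) bound ?_
  have hc : Continuous fun g : L2 => C * ((‖one‖ + ‖g‖ + ‖f‖) * ‖g - f‖) := by fun_prop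
  simpa using hc.tendsto f

theorem tendsto_integral_Fln {f : L2} (hf : f ∈ Kcone) :
    Tendsto (fun n : ℕ => ∫ θ, Fln n (f θ) ∂leb01) atTop
      (nhds (∫ θ, (f θ * Real.log (f θ) - f θ + 1) ∂leb01)) := by
  have hm := Lp.memLp f
  have hI : Integrable (fun θ => (1 + f θ) ^ 2) leb01 :=
    ((memLp_const (1 : ℝ)).add hm).integrable_sq
  refine tendsto_integral_filter_of_dominated_convergence _ ?_ ?_ hI ?_
  · filter_upwards [eventually_ge_atTop 1] with n hn
    exact (integrable_Fln hn f).aestronglyMeasurable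
  · filter_upwards [eventually_ge_atTop 1] with n hn
    filter_upwards [show ∀ᵐ θ ∂leb01, 0 ≤ f θ from hf] with θ hθ
    rw [Real.norm_of_nonneg (Fln_nonneg hn _)]
    exact Fln_le_sq hn hθ
  · filter_upwards [show ∀ᵐ θ ∂leb01, 0 ≤ f θ from hf] with θ hθ
    exact tendsto_Fln hθ

theorem tendsto_integral_Fln_atTop {f : L2} (hf : f ∉ Kcone) :
    Tendsto (fun n : ℕ => ∫ θ, Fln n (f θ) ∂leb01) atTop atTop := by
  have hI : Integrable (fun θ => max (-f θ) 0) leb01 :=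
    ((Lp.memLp f).integrable one_le_two).neg_part
  have hpos : 0 < ∫ θ, max (-f θ) 0 ∂leb01 := by
    refine (integral_nonneg fun θ => le_max_right _ _).lt_of_ne' fun h0 => hf ?_
    rw [integral_eq_zero_iff_of_nonneg (fun θ => le_max_right _ _) hI] at h0
    filter_upwards [h0] with θ hθ
    have : max (-f θ) 0 = 0 := hθ
    linarith [le_max_left (-f θ) 0]
  have hlog : Tendsto (fun n : ℕ => (∫ θ, max (-f θ) 0 ∂leb01) * Real.log n) atTop atTop :=
    (Real.tendsto_log_atTop.comp tendsto_natCast_atTop_atTop).const_mul_atTop hpos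
  refine tendsto_atTop_mono' _ ?_ hlog
  filter_upwards [eventually_ge_atTop 1] with n hn
  rw [← integral_mul_const]
  exact integral_mono (hI.mul_const _) (integrable_Fln hn f)
    fun θ => negPart_mul_log_le_Fln hn (f θ)

theorem stmt6 [MeasurableSpace L2] [BorelSpace L2]
    (μ : Measure L2) [IsFiniteMeasure μ]
    (ψ : BoundedContinuousFunction L2 ℝ) :
    Tendsto
      (fun n : ℕ => ∫ f, ψ f * Real.exp (-(∫ θ, Fln n (f θ) ∂leb01)) ∂μ)
      atTop
      (nhds (∫ f, ψ f *
        Set.indicator Kcone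
          (fun g : L2 =>
            Real.exp (-(∫ θ, (g θ * Real.log (g θ) - g θ + 1) ∂leb01))) f ∂μ)) := by
  refine tendsto_integral_filter_of_dominated_convergence (fun _ => ‖ψ‖) ?_ ?_
    (integrable_const _) (ae_of_all _ fun f => Tendsto.const_mul _ ?_)
  · filter_upwards [eventually_ge_atTop 1] with n hn
    exact (ψ.continuous.mul
      (Real.continuous_exp.comp (continuous_integral_Fln hn).neg)).aestronglyMeasurable
  · filter_upwards [eventually_ge_atTop 1] with n hn
    refine ae_of_all _ fun f => ?_
    rw [norm_mul, Real.norm_of_nonneg (Real.exp_nonneg _)]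
    refine (mul_le_of_le_one_right (norm_nonneg _) ?_).trans (ψ.norm_coe_le_norm f)
    exact Real.exp_le_one_iff.2 (neg_nonpos.2 (integral_nonneg fun θ => Fln_nonneg hn _))
  · by_cases hf : f ∈ Kcone
    · rw [indicator_of_mem hf]
      exact (Real.continuous_exp.tendsto _).comp (tendsto_integral_Fln hf).neg
    · rw [indicator_of_notMem hf]
      exact Real.tendsto_exp_neg_atTop_nhds_zero.comp (tendsto_integral_Fln_atTop hf)
end
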